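/- arXiv:1607.02491 — 2 statements merged into one kernel-verified Lean document; each statement's English description precedes it below -/
import Mathlib

section
/- Let O(SP_q^{1|2}) be the quotient of the free associative ℂ-algebra on generators ξ, x, η by the two-sided ideal generated by x·ξ − q·ξ·x, x·η − q⁻¹·η·x, η·ξ + q²·ξ·η − s·(1−q)·x², ξ² and η², where q ∈ ℂ is nonzero and s² = q. Then the images of the ordered monomials x^k·ξ^l·η^m, with k ∈ ℕ and l, m ∈ {0, 1}, form a basis of O(SP_q^{1|2}) as a ℂ-vector space. -/
open FreeAlgebra

/-- The defining relations of `O(SP_q^{1|2})` on the free algebra over generators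
`ξ = ι 0`, `x = ι 1`, `η = ι 2` (here `s` plays the role of `q^{1/2}`):
`x·ξ = q·ξ·x`, `x·η = q⁻¹·η·x`, `η·ξ = −q²·ξ·η + s·(1−q)·x²`, `ξ² = 0`, `η² = 0`. -/
inductive SPRel (q s : ℂ) : FreeAlgebra ℂ (Fin 3) → FreeAlgebra ℂ (Fin 3) → Prop
  | rel1 : SPRel q s (ι ℂ (1 : Fin 3) * ι ℂ (0 : Fin 3)) (q • (ι ℂ (0 : Fin 3) * ι ℂ (1 : Fin 3)))
  | rel2 : SPRel q s (ι ℂ (1 : Fin 3) * ι ℂ (2 : Fin 3)) (q⁻¹ • (ι ℂ (2 : Fin 3) * ι ℂ (1 : Fin 3)))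
  | rel3 : SPRel q s (ι ℂ (2 : Fin 3) * ι ℂ (0 : Fin 3))
      ((-(q ^ 2)) • (ι ℂ (0 : Fin 3) * ι ℂ (2 : Fin 3)) + (s * (1 - q)) • (ι ℂ (1 : Fin 3)) ^ 2)
  | rel4 : SPRel q s ((ι ℂ (0 : Fin 3)) ^ 2) 0
  | rel5 : SPRel q s ((ι ℂ (2 : Fin 3)) ^ 2) 0

/-- `O(SP_q^{1|2})`: the quotient of the free algebra on `ξ, x, η` by the two-sided
ideal generated by the defining relations. -/
abbrev OSP (q s : ℂ) := RingQuot (SPRel q s)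

/-- The image in `O(SP_q^{1|2})` of the ordered monomial `x^k·ξ^l·η^m`. -/
noncomputable def mono (q s : ℂ) : ℕ × Fin 2 × Fin 2 → OSP q s :=
  fun t => RingQuot.mkAlgHom ℂ (SPRel q s)
    ((ι ℂ (1 : Fin 3)) ^ t.1 * (ι ℂ (0 : Fin 3)) ^ (t.2.1 : ℕ) * (ι ℂ (2 : Fin 3)) ^ (t.2.2 : ℕ))

/-- The carrier of the left regular representation, with basis the ordered monomials. -/
abbrev OSPMod := (ℕ × Fin 2 × Fin 2) →₀ ℂ

/-- Basis vector of the representation. -/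
noncomputable def bv (k : ℕ) (l m : Fin 2) : OSPMod := Finsupp.single (k, l, m) 1

/-- Left multiplication by `x`. -/
noncomputable def opX : OSPMod →ₗ[ℂ] OSPMod :=
  Finsupp.linearCombination ℂ fun t => bv (t.1 + 1) t.2.1 t.2.2

/-- Left multiplication by `ξ`. -/
noncomputable def opXi (q : ℂ) : OSPMod →ₗ[ℂ] OSPMod :=
  Finsupp.linearCombination ℂ fun t =>
    if t.2.1 = 0 then (q⁻¹) ^ t.1 • bv t.1 1 t.2.2 else 0

/-- Left multiplication by `η`. -/
noncomputable def opEta (q s : ℂ) : OSPMod →ₗ[ℂ] OSPMod :=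
  Finsupp.linearCombination ℂ fun t =>
    if t.2.1 = 0 then
      (if t.2.2 = 0 then q ^ t.1 • bv t.1 0 1 else 0)
    else
      (if t.2.2 = 0 then (-(q ^ 2) * q ^ t.1) • bv t.1 1 1 else 0)
        + (s * (1 - q) * q ^ t.1) • bv (t.1 + 2) 0 t.2.2

lemma opX_bv (k : ℕ) (l m : Fin 2) : opX (bv k l m) = bv (k + 1) l m := by
  simp [opX, bv]

lemma opXi_bv0 (q : ℂ) (k : ℕ) (m : Fin 2) :
    opXi q (bv k 0 m) = (q⁻¹) ^ k • bv k 1 m := by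
  simp [opXi, bv]

lemma opXi_bv1 (q : ℂ) (k : ℕ) (m : Fin 2) : opXi q (bv k 1 m) = 0 := by
  simp [opXi, bv]

lemma opEta_bv00 (q s : ℂ) (k : ℕ) : opEta q s (bv k 0 0) = q ^ k • bv k 0 1 := by
  simp [opEta, bv]

lemma opEta_bv01 (q s : ℂ) (k : ℕ) : opEta q s (bv k 0 1) = 0 := by
  simp [opEta, bv]

lemma opEta_bv10 (q s : ℂ) (k : ℕ) : opEta q s (bv k 1 0) =
    (-(q ^ 2) * q ^ k) • bv k 1 1 + (s * (1 - q) * q ^ k) • bv (k + 2) 0 0 := by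
  simp [opEta, bv]

lemma opEta_bv11 (q s : ℂ) (k : ℕ) : opEta q s (bv k 1 1) =
    (s * (1 - q) * q ^ k) • bv (k + 2) 0 1 := by
  simp [opEta, bv]

lemma end_ext (f g : Module.End ℂ OSPMod)
    (h : ∀ k, (f (bv k 0 0) = g (bv k 0 0) ∧ f (bv k 0 1) = g (bv k 0 1)) ∧
      (f (bv k 1 0) = g (bv k 1 0) ∧ f (bv k 1 1) = g (bv k 1 1))) : f = g := by
  apply Finsupp.lhom_ext'
  rintro ⟨k, l, m⟩
  apply LinearMap.ext_ring
  change f (bv k l m) = g (bv k l m)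
  obtain ⟨⟨h1, h2⟩, h3, h4⟩ := h k
  fin_cases l <;> fin_cases m <;> assumption

/-- The generators acting on the representation. -/
noncomputable def opGen (q s : ℂ) : Fin 3 → Module.End ℂ OSPMod :=
  ![opXi q, opX, opEta q s]

lemma opGen_rel (q s : ℂ) (hq : q ≠ 0) ⦃a b : FreeAlgebra ℂ (Fin 3)⦄ (h : SPRel q s a b) :
    FreeAlgebra.lift ℂ (opGen q s) a = FreeAlgebra.lift ℂ (opGen q s) b := by
  cases h <;> apply end_ext <;> intro k <;>
    refine ⟨⟨?_, ?_⟩, ?_, ?_⟩ <;>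
    simp [opGen, pow_two, opX_bv, opXi_bv0, opXi_bv1, opEta_bv00, opEta_bv01, opEta_bv10,
      opEta_bv11, smul_smul, -neg_smul, -neg_mul] <;>
    (try match_scalars) <;> (try field_simp) <;> (try ring)

/-- The left regular representation. -/
noncomputable def rep (q s : ℂ) (hq : q ≠ 0) : OSP q s →ₐ[ℂ] Module.End ℂ OSPMod :=
  RingQuot.liftAlgHom ℂ ⟨FreeAlgebra.lift ℂ (opGen q s), opGen_rel q s hq⟩

lemma opX_pow (n k : ℕ) (l m : Fin 2) : (opX ^ n) (bv k l m) = bv (k + n) l m := by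
  induction n with
  | zero => simp
  | succ n ih => rw [pow_succ', Module.End.mul_apply, ih, opX_bv, add_assoc]

lemma rep_mono (q s : ℂ) (hq : q ≠ 0) (t : ℕ × Fin 2 × Fin 2) :
    rep q s hq (mono q s t) (bv 0 0 0) = Finsupp.single t 1 := by
  obtain ⟨k, l, m⟩ := t
  change _ = bv k l m
  have h0 : ∀ l m : Fin 2, (opXi q ^ (l : ℕ)) ((opEta q s ^ (m : ℕ)) (bv 0 0 0)) = bv 0 l m := by
    intro l m
    fin_cases l <;> fin_cases m <;> simp [opXi_bv0, opEta_bv00]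
  simp only [rep, mono, RingQuot.liftAlgHom_mkAlgHom_apply]
  simp only [map_mul, map_pow, FreeAlgebra.lift_ι_apply, Module.End.mul_apply]
  simp only [opGen, Matrix.cons_val]
  rw [h0, opX_pow, zero_add]

lemma mono_indep (q s : ℂ) (hq : q ≠ 0) : LinearIndependent ℂ (mono q s) := by
  let φ : OSP q s →ₗ[ℂ] OSPMod :=
    (LinearMap.applyₗ (bv 0 0 0)).comp (rep q s hq).toLinearMap
  apply LinearIndependent.of_comp φ
  have : (φ ∘ mono q s) = fun t => Finsupp.single t (1 : ℂ) := by
    funext t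
    exact rep_mono q s hq t
  rw [this]
  exact Finsupp.linearIndependent_single_one ℂ _

/-- The image of a generator. -/
noncomputable def gen (q s : ℂ) (i : Fin 3) : OSP q s := RingQuot.mkAlgHom ℂ (SPRel q s) (ι ℂ i)

lemma mono_eq (q s : ℂ) (k : ℕ) (l m : Fin 2) :
    mono q s (k, l, m) = gen q s 1 ^ k * gen q s 0 ^ (l : ℕ) * gen q s 2 ^ (m : ℕ) := by
  simp [mono, gen]

lemma xi_x (q s : ℂ) (hq : q ≠ 0) : gen q s 0 * gen q s 1 = q⁻¹ • (gen q s 1 * gen q s 0) := by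
  have := RingQuot.mkAlgHom_rel ℂ (SPRel.rel1 (q := q) (s := s))
  simp only [map_mul, map_smul] at this
  simp only [gen]
  rw [this, smul_smul, inv_mul_cancel₀ hq, one_smul]

lemma eta_x (q s : ℂ) (hq : q ≠ 0) : gen q s 2 * gen q s 1 = q • (gen q s 1 * gen q s 2) := by
  have := RingQuot.mkAlgHom_rel ℂ (SPRel.rel2 (q := q) (s := s))
  simp only [map_mul, map_smul] at this
  simp only [gen]
  rw [this, smul_smul, mul_inv_cancel₀ hq, one_smul]

lemma eta_xi (q s : ℂ) : gen q s 2 * gen q s 0 =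
    (-(q ^ 2)) • (gen q s 0 * gen q s 2) + (s * (1 - q)) • gen q s 1 ^ 2 := by
  have := RingQuot.mkAlgHom_rel ℂ (SPRel.rel3 (q := q) (s := s))
  simpa only [gen, map_mul, map_smul, map_add, map_pow] using this

lemma xi_xi (q s : ℂ) : gen q s 0 * gen q s 0 = 0 := by
  have := RingQuot.mkAlgHom_rel ℂ (SPRel.rel4 (q := q) (s := s))
  simpa only [gen, map_mul, map_zero, pow_two] using this

lemma eta_eta (q s : ℂ) : gen q s 2 * gen q s 2 = 0 := by
  have := RingQuot.mkAlgHom_rel ℂ (SPRel.rel5 (q := q) (s := s))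
  simpa only [gen, map_mul, map_zero, pow_two] using this

lemma comm_pow {A : Type*} [Ring A] [Algebra ℂ A] (a b : A) (c : ℂ) (h : a * b = c • (b * a))
    (k : ℕ) : a * b ^ k = c ^ k • (b ^ k * a) := by
  induction k with
  | zero => simp
  | succ n ih =>
    rw [pow_succ, ← mul_assoc, ih, smul_mul_assoc, mul_assoc, h, mul_smul_comm, smul_smul,
      ← mul_assoc, pow_succ]

lemma gen_mul_mono (q s : ℂ) (hq : q ≠ 0) (i : Fin 3) (t : ℕ × Fin 2 × Fin 2) :
    gen q s i * mono q s t ∈ Submodule.span ℂ (Set.range (mono q s)) := by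
  obtain ⟨k, l, m⟩ := t
  have hm : ∀ k l m, mono q s (k, l, m) ∈ Submodule.span ℂ (Set.range (mono q s)) :=
    fun k l m => Submodule.subset_span ⟨_, rfl⟩
  have hxi := comm_pow _ _ _ (xi_x q s hq) k
  have heta := comm_pow _ _ _ (eta_x q s hq) k
  fin_cases i
  · -- left multiplication by `ξ`
    change gen q s 0 * _ ∈ _
    fin_cases l
    · have : gen q s 0 * mono q s (k, 0, m) = q⁻¹ ^ k • mono q s (k, 1, m) := by
        rw [mono_eq, mono_eq, ← mul_assoc, ← mul_assoc, hxi]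
        simp
      change gen q s 0 * mono q s (k, 0, m) ∈ _
      rw [this]
      exact Submodule.smul_mem _ _ (hm _ _ _)
    · have : gen q s 0 * mono q s (k, 1, m) = 0 := by
        rw [mono_eq, ← mul_assoc, ← mul_assoc, hxi]
        simp [mul_assoc]
        simp [← mul_assoc (gen q s 0), xi_xi]
      change gen q s 0 * mono q s (k, 1, m) ∈ _
      rw [this]
      exact zero_mem _
  · -- left multiplication by `x`
    have : gen q s 1 * mono q s (k, l, m) = mono q s (k + 1, l, m) := by
      rw [mono_eq, mono_eq, pow_succ']
      simp only [mul_assoc]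
    change gen q s 1 * mono q s (k, l, m) ∈ _
    rw [this]
    exact hm _ _ _
  · -- left multiplication by `η`
    change gen q s 2 * mono q s (k, l, m) ∈ _
    have heta2 : ∀ m : Fin 2, gen q s 1 ^ k * gen q s 0 ^ (l : ℕ) *
        (gen q s 2 * gen q s 2 ^ (m : ℕ)) ∈ Submodule.span ℂ (Set.range (mono q s)) := by
      intro m
      fin_cases m
      · have := hm k l 1
        rw [mono_eq] at this
        simpa using this
      · simp [eta_eta]
    have h1 : gen q s 2 * mono q s (k, l, m) =
        q ^ k • (gen q s 1 ^ k * (gen q s 2 * gen q s 0 ^ (l : ℕ)) * gen q s 2 ^ (m : ℕ)) := by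
      rw [mono_eq, ← mul_assoc, ← mul_assoc, heta]
      simp only [smul_mul_assoc, mul_assoc]
    rw [h1]
    apply Submodule.smul_mem
    fin_cases l
    · simpa [mul_assoc] using heta2 m
    · have h2 : gen q s 1 ^ k * (gen q s 2 * gen q s 0 ^ (1 : ℕ)) * gen q s 2 ^ (m : ℕ) =
          (-(q ^ 2)) • (gen q s 1 ^ k * gen q s 0 ^ 1 * (gen q s 2 * gen q s 2 ^ (m : ℕ))) +
          (s * (1 - q)) • mono q s (k + 2, 0, m) := by
        rw [pow_one, eta_xi, mono_eq, pow_add]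
        simp only [mul_add, add_mul, mul_smul_comm, smul_mul_assoc, mul_assoc]
        simp
      change gen q s 1 ^ k * (gen q s 2 * gen q s 0 ^ (1 : ℕ)) * gen q s 2 ^ (m : ℕ) ∈ _
      rw [h2]
      exact add_mem (Submodule.smul_mem _ _ (heta2 m)) (Submodule.smul_mem _ _ (hm _ _ _))

lemma mul_mem_span (q s : ℂ) (hq : q ≠ 0) (a : FreeAlgebra ℂ (Fin 3)) :
    ∀ v ∈ Submodule.span ℂ (Set.range (mono q s)),
      RingQuot.mkAlgHom ℂ (SPRel q s) a * v ∈ Submodule.span ℂ (Set.range (mono q s)) := by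
  induction a using FreeAlgebra.induction with
  | grade0 r =>
    intro v hv
    rw [AlgHom.commutes, ← Algebra.smul_def]
    exact Submodule.smul_mem _ _ hv
  | grade1 i =>
    intro v hv
    induction hv using Submodule.span_induction with
    | mem x hx =>
      obtain ⟨t, rfl⟩ := hx
      exact gen_mul_mono q s hq i t
    | zero => simp
    | add x y _ _ hx hy => rw [mul_add]; exact add_mem hx hy
    | smul c x _ hx => rw [mul_smul_comm]; exact Submodule.smul_mem _ _ hx
  | mul a b ha hb =>
    intro v hv
    rw [map_mul, mul_assoc]
    exact ha _ (hb _ hv)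
  | add a b ha hb =>
    intro v hv
    rw [map_add, add_mul]
    exact add_mem (ha _ hv) (hb _ hv)

lemma mono_span (q s : ℂ) (hq : q ≠ 0) : Submodule.span ℂ (Set.range (mono q s)) = ⊤ := by
  rw [eq_top_iff]
  intro y _
  obtain ⟨a, rfl⟩ := RingQuot.mkAlgHom_surjective ℂ (SPRel q s) y
  have h1 : (1 : OSP q s) ∈ Submodule.span ℂ (Set.range (mono q s)) :=
    Submodule.subset_span ⟨(0, 0, 0), by simp [mono]⟩
  simpa using mul_mem_span q s hq a 1 h1

/-- The monomials `x^k·ξ^l·η^m` (`k ∈ ℕ`, `l, m ∈ {0,1}`) form a ℂ-vector space basis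
of `O(SP_q^{1|2})`: they are linearly independent and they span. -/
theorem stmt9 (q s : ℂ) (hq : q ≠ 0) (hs : s ^ 2 = q) :
    LinearIndependent ℂ (mono q s) ∧
      Submodule.span ℂ (Set.range (mono q s)) = ⊤ := by
  exact ⟨mono_indep q s hq, mono_span q s hq⟩
end

section
/- Fix h ∈ ℂ. For real q > 0 with q ≠ 1 let g(q) = [[1, 0, h/(q−1)], [0, 1, 0], [0, 0, 1]] and let B̂_q be the 9×9 matrix defined below with s = q^{1/2} the positive square root. Then there exists a 9×9 complex matrix B̂_h such that the matrix (g(q) ⊗ g(q))⁻¹ · B̂_q · (g(q) ⊗ g(q)) (Kronecker/tensor product of matrices) converges entrywise to B̂_h as q tends to 1 within (0,∞)\{1}. -/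
open Filter Topology Matrix Kronecker

/-- The 9×9 matrix `B̂_q` of the left-covariant calculus on `SP_q^{1|2}`, with rows and
columns indexed by pairs in `Fin 3 × Fin 3` (here `s` plays the role of `q^{1/2}`). -/
def Bmat (q s : ℂ) : Matrix (Fin 3 × Fin 3) (Fin 3 × Fin 3) ℂ :=
  Matrix.of fun p r =>
    if p = ((0 : Fin 3), (0 : Fin 3)) ∧ r = ((0 : Fin 3), (0 : Fin 3)) then -1
    else if p = (2, 2) ∧ r = (2, 2) then -1
    else if p = (1, 0) ∧ r = (0, 1) then q
    else if p = (0, 1) ∧ r = (1, 0) then q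
    else if p = (1, 1) ∧ r = (1, 1) then q
    else if p = (2, 1) ∧ r = (1, 2) then q
    else if p = (1, 2) ∧ r = (2, 1) then q
    else if p = (2, 0) ∧ r = (0, 2) then -q ^ 2
    else if p = (0, 2) ∧ r = (2, 0) then -q ^ 2
    else if p = (1, 0) ∧ r = (1, 0) then q ^ 2 - 1
    else if p = (2, 1) ∧ r = (2, 1) then q ^ 2 - 1
    else if p = (2, 0) ∧ r = (1, 1) then s * (q ^ 2 - 1)
    else if p = (1, 1) ∧ r = (2, 0) then -(s * (q ^ 2 - 1))
    else if p = (2, 0) ∧ r = (2, 0) then (1 + q) * (q ^ 2 - 1)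
    else 0

noncomputable section

/-- The change-of-basis matrix `g(q)` (with new deformation parameter `h`). -/
def gmat (h : ℂ) (q : ℝ) : Matrix (Fin 3) (Fin 3) ℂ :=
  !![1, 0, h / ((q : ℂ) - 1); 0, 1, 0; 0, 0, 1]

/-- The Kronecker product `g(q) ⊗ g(q)`. -/
def gk (h : ℂ) (q : ℝ) : Matrix (Fin 3 × Fin 3) (Fin 3 × Fin 3) ℂ :=
  gmat h q ⊗ₖ gmat h q

/-- The conjugated matrix, written with entries polynomial in `q`, `s`, `h`. -/
def Mconj (h q s : ℂ) : Matrix (Fin 3 × Fin 3) (Fin 3 × Fin 3) ℂ :=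
  Bmat q s + Matrix.of fun p r =>
    if p = ((0 : Fin 3), (0 : Fin 3)) ∧ r = ((0 : Fin 3), (2 : Fin 3)) then h * (q + 1)
    else if p = (0, 0) ∧ r = (1, 1) then -(s * (h * (q + 1)))
    else if p = (1, 0) ∧ r = (1, 2) then h * (q + 1)
    else if p = (0, 0) ∧ r = (2, 0) then -(q * (h * (q + 1)))
    else if p = (0, 1) ∧ r = (2, 1) then -(h * (q + 1))
    else if p = (0, 0) ∧ r = (2, 2) then -(h ^ 2 * (q + 1))
    else if p = (0, 2) ∧ r = (2, 2) then -(h * (q + 1))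
    else if p = (2, 0) ∧ r = (2, 2) then q * (h * (q + 1))
    else if p = (1, 1) ∧ r = (2, 2) then -(s * (h * (q + 1)))
    else 0

theorem continuous_ite_prop (P : Prop) [Decidable P] {f g : ℝ → ℂ}
    (hf : Continuous f) (hg : Continuous g) :
    Continuous fun q => if P then f q else g q := by
  by_cases hP : P
  · simpa [hP] using hf
  · simpa [hP] using hg

theorem Mconj_continuous (h : ℂ) :
    Continuous fun q : ℝ => Mconj h (q : ℂ) ((Real.sqrt q : ℝ) : ℂ) := by
  refine continuous_pi fun p => continuous_pi fun r => ?_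
  simp only [Mconj, Bmat, Matrix.add_apply, Matrix.of_apply]
  refine Continuous.add ?_ ?_
  · repeat (refine continuous_ite_prop _ (by fun_prop) ?_)
    fun_prop
  · repeat (refine continuous_ite_prop _ (by fun_prop) ?_)
    fun_prop

theorem gmat_det (h : ℂ) (q : ℝ) : (gmat h q).det = 1 := by
  simp [gmat, Matrix.det_fin_three]

set_option maxHeartbeats 4000000 in
theorem intertwine (h : ℂ) (q : ℝ) (s : ℂ) (hq : q ≠ 1) :
    Bmat (q : ℂ) s * gk h q = gk h q * Mconj h (q : ℂ) s := by
  have hq' : (q : ℂ) - 1 ≠ 0 := by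
    rw [sub_ne_zero]; exact_mod_cast hq
  obtain ⟨a, rfl⟩ : ∃ a, h = a * ((q : ℂ) - 1) := ⟨h / ((q : ℂ) - 1), by field_simp⟩
  simp only [gk, gmat, mul_div_cancel_right₀ _ hq']
  generalize (q : ℂ) = x
  ext ⟨i, l⟩ ⟨j, k⟩
  fin_cases i <;> fin_cases l <;> fin_cases j <;> fin_cases k <;>
    simp [Matrix.mul_apply, Fintype.sum_prod_type, Fin.sum_univ_three, Mconj, Bmat] <;> ring

/-- As `q → 1` along `(0,∞) \ {1}`, the matrix `(g(q) ⊗ g(q))⁻¹ · B̂_q · (g(q) ⊗ g(q))`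
(with `s = q^{1/2}` the positive square root) converges entrywise to some matrix `B̂_h`. -/
theorem stmt16 (h : ℂ) :
    ∃ Bh : Matrix (Fin 3 × Fin 3) (Fin 3 × Fin 3) ℂ,
      Tendsto (fun q : ℝ => (gk h q)⁻¹ * Bmat (q : ℂ) ((Real.sqrt q : ℝ) : ℂ) * gk h q)
        (nhdsWithin 1 (Set.Ioi (0 : ℝ) \ {1})) (nhds Bh) := by
  refine ⟨Mconj h ((1 : ℝ) : ℂ) ((Real.sqrt 1 : ℝ) : ℂ), ?_⟩
  have ht := ((Mconj_continuous h).tendsto 1).mono_left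
    (nhdsWithin_le_nhds (s := Set.Ioi (0 : ℝ) \ {1}))
  refine ht.congr' ?_
  filter_upwards [self_mem_nhdsWithin] with q hq
  have hdet : IsUnit (gk h q).det := by
    simp [gk, Matrix.det_kronecker, gmat_det]
  rw [Matrix.mul_assoc, intertwine h q _ hq.2, Matrix.nonsing_inv_mul_cancel_left _ _ hdet]

end
end
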